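/- Let K be a field extension of ℚ that is finitely generated as a field. For every natural number d there exist infinitely many primes p such that the degree [K(ω_p) : K] ≥ d, where ω_p is a primitive p-th root of unity. -/

import Mathlib

open Polynomial in
/-- Over the fraction field `L` of an integrally closed domain `R` that admits a ring homomorphism
to `ℚ`, every cyclotomic polynomial stays irreducible. -/
theorem IsPrimitiveRoot.natDegree_minpoly_of_ringHom_rat {R L E : Type*} [CommRing R] [IsDomain R]
    [IsIntegrallyClosed R] [Field L] [Algebra R L] [IsFractionRing R L] [Field E] [Algebra L E]
    [CharZero E] (φ : R →+* ℚ) {n : ℕ} (hn : 0 < n) {ω : E} (hω : IsPrimitiveRoot ω n) :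
    (minpoly L ω).natDegree = n.totient := by
  let : Algebra R E := ((algebraMap L E).comp (algebraMap R L)).toAlgebra
  have : IsScalarTower R L E := .of_algebraMap_eq fun _ ↦ rfl
  have : FaithfulSMul R E := (faithfulSMul_iff_algebraMap_injective R E).2
    ((algebraMap L E).injective.comp (IsFractionRing.injective R L))
  have hroot : aeval ω (cyclotomic n R) = 0 := by
    rw [aeval_def, eval₂_eq_eval_map, map_cyclotomic]
    exact hω.isRoot_cyclotomic hn
  have hint : IsIntegral R ω := ⟨_, cyclotomic.monic n R, hroot⟩
  have hmonic := minpoly.monic hint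
  have hdvd : (minpoly R ω).map φ ∣ cyclotomic n ℚ := by
    rw [← map_cyclotomic n φ]
    exact map_dvd φ (minpoly.isIntegrallyClosed_dvd hint hroot)
  have hunit : ¬ IsUnit ((minpoly R ω).map φ) := fun h ↦ by
    have hdeg := natDegree_eq_zero_of_isUnit h
    rw [hmonic.natDegree_map] at hdeg
    exact (minpoly.natDegree_pos hint).ne' hdeg
  have hassoc := ((cyclotomic.irreducible_rat hn).dvd_iff.1 hdvd).resolve_left hunit
  have heq := eq_of_monic_of_associated (cyclotomic.monic n ℚ) (hmonic.map φ) hassoc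
  rw [minpoly.isIntegrallyClosed_eq_field_fractions' L hint, hmonic.natDegree_map,
    ← hmonic.natDegree_map φ, ← heq, natDegree_cyclotomic]

open scoped IntermediateField.algebraAdjoinAdjoin in
/-- Adjoining a primitive `n`-th root of unity to a purely transcendental extension of `ℚ` has
degree `φ(n)`. -/
theorem AlgebraicIndependent.natDegree_minpoly_of_isPrimitiveRoot {ι K E : Type*} [Field K]
    [Algebra ℚ K] {x : ι → K} (hx : AlgebraicIndependent ℚ x) [Field E]
    [Algebra (IntermediateField.adjoin ℚ (Set.range x)) E] {n : ℕ} (hn : 0 < n) {ω : E}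
    (hω : IsPrimitiveRoot ω n) :
    (minpoly (IntermediateField.adjoin ℚ (Set.range x)) ω).natDegree = n.totient := by
  have : CharZero E :=
    charZero_of_injective_algebraMap
      (algebraMap (IntermediateField.adjoin ℚ (Set.range x)) E).injective
  have : IsIntegrallyClosed (Algebra.adjoin ℚ (Set.range x)) :=
    .of_equiv hx.aevalEquiv.toRingEquiv
  exact hω.natDegree_minpoly_of_ringHom_rat (R := Algebra.adjoin ℚ (Set.range x))
    (MvPolynomial.constantCoeff.comp hx.aevalEquiv.symm.toRingEquiv.toRingHom) hn

/-- For a field `K` that is a finitely generated extension of `ℚ` and any `d : ℕ`, there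
are infinitely many primes `p` such that `[K(ω_p) : K] ≥ d` for `ω_p` a primitive `p`-th
root of unity (taken in an algebraic closure of `K`). -/
theorem infinitely_many_primes_large_cyclotomic_degree (K : Type) [Field K] [Algebra ℚ K]
    (hfg : ∃ S : Finset K, IntermediateField.adjoin ℚ (S : Set K) = ⊤) (d : ℕ) :
    {p : ℕ | p.Prime ∧ ∀ ω : AlgebraicClosure K, IsPrimitiveRoot ω p →
      d ≤ Module.finrank K (IntermediateField.adjoin K {ω})}.Infinite := by
  have : Algebra.EssFiniteType ℚ K := IntermediateField.fg_top_iff.1 hfg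
  obtain ⟨ι, x, hx⟩ := exists_isTranscendenceBasis' ℚ K
  let L := IntermediateField.adjoin ℚ (Set.range x)
  have : Algebra.IsAlgebraic L K := hx.isAlgebraic_field
  have : Algebra.EssFiniteType L K := .of_comp ℚ L K
  have : Module.Finite L K := Algebra.finite_of_essFiniteType_of_isAlgebraic
  have hpos : 0 < Module.finrank L K := Module.finrank_pos
  refine Set.infinite_of_forall_exists_gt fun N ↦ ?_
  obtain ⟨p, hle, hp⟩ := Nat.exists_infinite_primes (N + Module.finrank L K * d + 1)
  refine ⟨p, ⟨hp, fun ω hω ↦ ?_⟩, by omega⟩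
  have hωint : IsIntegral K ω := Algebra.IsIntegral.isIntegral ω
  have : FiniteDimensional K (IntermediateField.adjoin K {ω}) :=
    IntermediateField.adjoin.finiteDimensional hωint
  have : FiniteDimensional L (IntermediateField.adjoin K {ω}) :=
    FiniteDimensional.trans L K _
  have hgen : IsPrimitiveRoot (IntermediateField.AdjoinSimple.gen K ω) p :=
    .of_map_of_injective (f := algebraMap (IntermediateField.adjoin K {ω}) (AlgebraicClosure K))
      (by simpa using hω) (FaithfulSMul.algebraMap_injective _ _)
  have hdeg := hx.1.natDegree_minpoly_of_isPrimitiveRoot hp.pos hgen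
  have hbound := minpoly.natDegree_le (A := L) (IntermediateField.AdjoinSimple.gen K ω)
  rw [hdeg, Nat.totient_prime hp, ← Module.finrank_mul_finrank L K] at hbound
  exact Nat.le_of_mul_le_mul_left (by omega) hpos
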